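/- Let w be a Bergman weight with h_0 = 1 whose moments satisfy h_{2m}/h_{2(m-1)} ≥ h_{2(m+1)}/((m+1)·h_{2(m-1)}) + (m/(m+1))·h_{2(m+1)}/h_{2m} for all integers m ≥ 1. Then for every integer n ≥ 1, h_{2(n+1)}/(n+1) ≤ h_{2n}·ln(∑_{k=0}^∞ h_{2k}/(k!)²). -/

import Mathlib

open MeasureTheory

/-- The `m`-th moment `h_m = ∫₀¹ ρ^{m+1} w(ρ) dρ` of a weight `w` on `[0,1)`. -/
noncomputable def moment (w : ℝ → ℝ) (m : ℕ) : ℝ :=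
  ∫ ρ in (0:ℝ)..1, ρ ^ (m + 1) * w ρ

/-- Moments of a nonnegative weight are nonnegative. -/
theorem moment_nonneg {w : ℝ → ℝ} (hw : ∀ ρ ∈ Set.Ico (0:ℝ) 1, 0 ≤ w ρ) (m : ℕ) :
    0 ≤ moment w m := by
  rw [moment, intervalIntegral.integral_of_le zero_le_one, integral_Ioc_eq_integral_Ioo]
  exact setIntegral_nonneg measurableSet_Ioo fun ρ hρ =>
    mul_nonneg (pow_nonneg hρ.1.le _) (hw ρ ⟨hρ.1.le, hρ.2⟩)

/-- If some moment of a nonnegative weight is nonzero, then all its moments are positive. -/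
theorem moment_pos {w : ℝ → ℝ} (hw : ∀ ρ ∈ Set.Ico (0:ℝ) 1, 0 ≤ w ρ)
    (hint : ∀ m : ℕ, IntervalIntegrable (fun ρ => ρ ^ (m + 1) * w ρ) volume 0 1)
    {k : ℕ} (hk : moment w k ≠ 0) (m : ℕ) : 0 < moment w m := by
  refine (moment_nonneg hw m).lt_of_ne' fun h => hk ?_
  rw [moment, intervalIntegral.integral_of_le zero_le_one, integral_Ioc_eq_integral_Ioo] at h ⊢
  have hi : IntegrableOn (fun ρ => ρ ^ (m + 1) * w ρ) (Set.Ioo 0 1) :=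
    ((intervalIntegrable_iff_integrableOn_Ioo_of_le zero_le_one).1 (hint m))
  have hn : 0 ≤ᵐ[volume.restrict (Set.Ioo (0:ℝ) 1)] fun ρ => ρ ^ (m + 1) * w ρ := by
    filter_upwards [ae_restrict_mem measurableSet_Ioo] with ρ hρ
    exact mul_nonneg (pow_nonneg hρ.1.le _) (hw ρ ⟨hρ.1.le, hρ.2⟩)
  have hz := (integral_eq_zero_iff_of_nonneg_ae hn hi).1 h
  refine integral_eq_zero_of_ae ?_
  filter_upwards [hz, ae_restrict_mem measurableSet_Ioo] with ρ h1 hρ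
  have hw0 : w ρ = 0 := (mul_eq_zero.1 h1).resolve_left (pow_ne_zero _ hρ.1.ne')
  simp [hw0]

/-- The moments of a nonnegative weight form a decreasing sequence. -/
theorem moment_antitone {w : ℝ → ℝ} (hw : ∀ ρ ∈ Set.Ico (0:ℝ) 1, 0 ≤ w ρ)
    (hint : ∀ m : ℕ, IntervalIntegrable (fun ρ => ρ ^ (m + 1) * w ρ) volume 0 1) :
    Antitone (moment w) := by
  intro k m hkm
  refine intervalIntegral.integral_mono_on_of_le_Ioo zero_le_one (hint m) (hint k) fun ρ hρ => ?_
  exact mul_le_mul_of_nonneg_right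
    (pow_le_pow_of_le_one hρ.1.le hρ.2.le (Nat.add_le_add_right hkm 1))
    (hw ρ ⟨hρ.1.le, hρ.2⟩)

/-- **Lemma 2.** If the moments of a Bergman weight `w` satisfy
`h_{2m}/h_{2(m-1)} ≥ h_{2(m+1)}/((m+1)h_{2(m-1)}) + (m/(m+1))·h_{2(m+1)}/h_{2m}`
for all `m ≥ 1`, then `h_{2(n+1)}/(n+1) ≤ h_{2n}·ln(∑ h_{2k}/(k!)²)` for all `n ≥ 1`. -/
theorem lemma_two (w : ℝ → ℝ)
    (hw_nonneg : ∀ ρ ∈ Set.Ico (0:ℝ) 1, 0 ≤ w ρ)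
    (hw_int : ∀ m : ℕ, IntervalIntegrable (fun ρ => ρ ^ (m + 1) * w ρ) volume 0 1)
    (h0 : moment w 0 = 1)
    (hcond : ∀ m : ℕ, 1 ≤ m →
      moment w (2 * (m + 1)) / ((m + 1) * moment w (2 * (m - 1))) +
          ((m : ℝ) / (m + 1)) * (moment w (2 * (m + 1)) / moment w (2 * m)) ≤
        moment w (2 * m) / moment w (2 * (m - 1)))
    (n : ℕ) (hn : 1 ≤ n) :
    moment w (2 * (n + 1)) / (n + 1) ≤
      moment w (2 * n) *
        Real.log (∑' k : ℕ, moment w (2 * k) / (Nat.factorial k : ℝ) ^ 2) := by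
  have hpos := moment_pos hw_nonneg hw_int (k := 0) (by simp [h0])
  have hle (m : ℕ) : moment w m ≤ 1 :=
    h0 ▸ moment_antitone hw_nonneg hw_int (Nat.zero_le m)
  set r : ℕ → ℝ := fun m => moment w (2 * (m + 1)) / ((m + 1) * moment w (2 * m)) with hr
  have hrpos (m : ℕ) : 0 < r m := div_pos (hpos _) (mul_pos (by positivity) (hpos _))
  have hrec (m : ℕ) : r (m + 1) * (1 + r m) ≤ r m := by
    have h := hcond (m + 1) (by omega)
    have h1 := hpos (2 * m)
    have h2 := hpos (2 * (m + 1))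
    have h3 := hpos (2 * (m + 1 + 1))
    simp only [Nat.add_sub_cancel] at h
    simp only [hr]
    push_cast at h ⊢
    refine le_of_mul_le_mul_left (le_trans (le_of_eq ?_) (h.trans (le_of_eq ?_)))
      (show (0:ℝ) < m + 1 by positivity) <;> field_simp
    ring
  have hanti : Antitone r := antitone_nat_of_succ_le fun m => by
    nlinarith [hrec m, mul_pos (hrpos (m + 1)) (hrpos m)]
  have hr0 : r 0 = moment w 2 := by simp [hr, h0]
  have hr1 : r n ≤ r 0 / (1 + r 0) :=
    (hanti hn).trans ((le_div_iff₀ (by linarith [hrpos 0])).2 (hrec 0))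
  have hsum : Summable fun k : ℕ => moment w (2 * k) / (Nat.factorial k : ℝ) ^ 2 := by
    refine Summable.of_nonneg_of_le (fun k => div_nonneg (hpos _).le (by positivity))
      (fun k => ?_) (Real.summable_pow_div_factorial 1)
    have hf : (1:ℝ) ≤ Nat.factorial k := by exact_mod_cast Nat.factorial_pos k
    rw [one_pow]
    exact div_le_div₀ zero_le_one (hle _) (by positivity) (by nlinarith)
  have hS : 1 + r 0 ≤ ∑' k : ℕ, moment w (2 * k) / (Nat.factorial k : ℝ) ^ 2 := by
    have h := hsum.sum_le_tsum (Finset.range 2)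
      fun k _ => div_nonneg (hpos _).le (by positivity)
    simpa [Finset.sum_range_succ, h0, hr0] using h
  have hp : 0 < 1 + r 0 := by linarith [hrpos 0]
  have hlog : r n ≤ Real.log (∑' k : ℕ, moment w (2 * k) / (Nat.factorial k : ℝ) ^ 2) := by
    refine hr1.trans (le_trans ?_ (Real.log_le_log hp hS))
    refine (le_of_eq ?_).trans (Real.one_sub_inv_le_log_of_pos hp)
    field_simp
    ring
  refine (le_of_eq ?_).trans (mul_le_mul_of_nonneg_left hlog (hpos (2 * n)).le)
  have := (hpos (2 * n)).ne'
  simp only [hr]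
  field_simp
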